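/- Let p be a stochastic language, let 0 ≤ η ≤ 1, let U, V be finite subsets of Σ* such that every string in U ∪ V has length at most ℓ, assume S_{p̄_η}^{(1)} < ∞, and for a string w ∈ Σ* let Z̄_{η,w} be the U×V matrix Z̄_{η,w}[u,v] = ∑_{x∈Σ*} η^{|x|}·(1_{w=uvx} − p(uvx)). Then for every w ∈ Σ*: ‖Z̄_{η,w}‖₂ ≤ min(ℓ+1, 1/(1−η)) + S_{p̄_η}^{(1)}, where 1/(1−η) is interpreted as +∞ when η = 1. -/

import Mathlib

open Matrix

/-- The spectral norm (largest singular value) of a real matrix. -/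
noncomputable def specNorm {m n : Type*} [Fintype m] [Fintype n] [DecidableEq n]
    (M : Matrix m n ℝ) : ℝ :=
  ‖(Matrix.toEuclideanLin M).toContinuousLinearMap‖

open Finset in
/-- Schur's test: a common bound on the absolute row and column sums bounds the spectral norm. -/
lemma specNorm_le_of_sum_abs_le {m n : Type*} [Fintype m] [Fintype n] [DecidableEq n]
    (M : Matrix m n ℝ) {C : ℝ} (hC : 0 ≤ C) (hrow : ∀ i, ∑ j, |M i j| ≤ C)
    (hcol : ∀ j, ∑ i, |M i j| ≤ C) : specNorm M ≤ C := by
  refine ContinuousLinearMap.opNorm_le_bound _ hC fun x => ?_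
  refine le_of_sq_le_sq ?_ (by positivity)
  rw [mul_pow, EuclideanSpace.norm_sq_eq, EuclideanSpace.norm_sq_eq]
  have hentry (i : m) : (∑ j, M i j * x j) ^ 2 ≤ C * ∑ j, |M i j| * x j ^ 2 := by
    have hcs := sum_sq_le_sum_mul_sum_of_sq_le_mul univ
      (r := fun j => M i j * x j) (f := fun j => |M i j|) (g := fun j => |M i j| * x j ^ 2)
      (fun j _ => abs_nonneg _) (fun j _ => by positivity)
      (fun j _ => by rw [mul_pow, ← sq_abs (M i j), sq, mul_assoc])
    exact hcs.trans (mul_le_mul_of_nonneg_right (hrow i) (by positivity))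
  calc _ = ∑ i, (∑ j, M i j * x j) ^ 2 := by
        refine sum_congr rfl fun i _ => ?_
        rw [Real.norm_eq_abs, sq_abs]
        rfl
    _ ≤ ∑ i, C * ∑ j, |M i j| * x j ^ 2 := sum_le_sum fun i _ => hentry i
    _ = C * ∑ j, (∑ i, |M i j|) * x j ^ 2 := by
        rw [← mul_sum, sum_comm]
        simp_rw [sum_mul]
    _ ≤ C * ∑ j, C * x j ^ 2 := by
        gcongr with j
        exact hcol j
    _ = C ^ 2 * ∑ j, ‖x j‖ ^ 2 := by
        simp_rw [Real.norm_eq_abs, sq_abs]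
        rw [← mul_sum]
        ring

lemma sum_le_tsum_of_injective {ι β : Type*} [Fintype ι] {φ : ι → β} {g : β → ℝ}
    (hφ : Function.Injective φ) (hg0 : ∀ y, 0 ≤ g y) (hg : Summable g) :
    ∑ i, g (φ i) ≤ ∑' y, g y := by
  rw [← tsum_fintype (L := .unconditional ι)]
  exact (hg.comp_injective hφ).tsum_le_tsum_of_inj φ hφ (fun y _ => hg0 y) (fun _ => le_rfl) hg

section Lists

variable {α : Type*}

lemma hasSum_pow_length_mul_indicator [DecidableEq α] (η : ℝ) (w y : List α) :
    HasSum (fun x : List α => η ^ x.length * (if w = y ++ x then (1 : ℝ) else 0))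
      (if y <+: w then η ^ (w.length - y.length) else 0) := by
  split_ifs with h
  · obtain ⟨t, rfl⟩ := h
    convert hasSum_single t ?_ using 1
    · simp
    · intro x hx
      simp [Ne.symm hx]
  · convert hasSum_zero using 2
    rw [if_neg (fun e => h ⟨_, e.symm⟩), mul_zero]

lemma summable_pow_length_mul_append {p : List α → ℝ} (hp0 : ∀ w, 0 ≤ p w) (hp : Summable p)
    {η : ℝ} (hη0 : 0 ≤ η) (hη1 : η ≤ 1) (y : List α) :
    Summable fun x : List α => η ^ x.length * p (y ++ x) :=
  Summable.of_nonneg_of_le (fun _ => mul_nonneg (pow_nonneg hη0 _) (hp0 _))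
    (fun _ => mul_le_of_le_one_left (hp0 _) (pow_le_one₀ hη0 hη1))
    (hp.comp_injective (List.append_right_injective y))

lemma injOn_length_prefix {ι : Type*} {φ : ι → List α} (hφ : Function.Injective φ) (w : List α) :
    Set.InjOn (fun i => (φ i).length) {i | φ i <+: w} := by
  intro i hi j hj hij
  exact hφ ((List.prefix_of_prefix_length_le hi hj hij.le).eq_of_length hij)

section PrefixSum

variable [DecidableEq α] {ι : Type*} [Fintype ι] {φ : ι → List α} {η : ℝ}

lemma sum_prefix_pow_le_add_one (hφ : Function.Injective φ) (hη0 : 0 ≤ η) (hη1 : η ≤ 1)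
    (w : List α) {c ℓ : ℕ} (hlo : ∀ i, c ≤ (φ i).length) (hhi : ∀ i, (φ i).length ≤ c + ℓ) :
    ∑ i, (if φ i <+: w then η ^ (w.length - (φ i).length) else 0) ≤ (ℓ : ℝ) + 1 := by
  rw [← Finset.sum_filter]
  refine (Finset.sum_le_card_nsmul _ _ 1 fun i _ => pow_le_one₀ hη0 hη1).trans ?_
  have hcard := Finset.card_le_card_of_injOn (s := {i | φ i <+: w})
    (t := Finset.Icc c (c + ℓ)) (fun i => (φ i).length)
    (fun i _ => by simpa using ⟨hlo i, hhi i⟩)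
    ((injOn_length_prefix hφ w).mono (by intro i; simp))
  rw [Nat.card_Icc, add_assoc, Nat.add_sub_cancel_left] at hcard
  rw [nsmul_one]
  exact_mod_cast hcard

lemma sum_prefix_pow_le_geometric (hφ : Function.Injective φ) (hη0 : 0 ≤ η) (hη1 : η < 1)
    (w : List α) :
    ∑ i, (if φ i <+: w then η ^ (w.length - (φ i).length) else 0) ≤ 1 / (1 - η) := by
  rw [← Finset.sum_filter]
  have hinj : Set.InjOn (fun i => w.length - (φ i).length)
      ({i | φ i <+: w} : Finset ι) := by
    intro i hi j hj hij
    simp only [Finset.coe_filter, Finset.mem_univ, true_and, Set.mem_ofPred_eq] at hi hj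
    have hi' := hi.length_le
    have hj' := hj.length_le
    exact injOn_length_prefix hφ w hi hj (by dsimp only at hij ⊢; omega)
  rw [← Finset.sum_image (f := fun n => η ^ n) hinj, one_div,
    ← tsum_geometric_of_lt_one hη0 hη1]
  exact (summable_geometric_of_lt_one hη0 hη1).sum_le_tsum _ fun n _ => pow_nonneg hη0 n

end PrefixSum

end Lists

/-- for a stochastic language `p`, `0 ≤ η ≤ 1`, finite `U, V ⊆ Σ*` whose
strings have length at most `ℓ`, `S_{p̄_η}⁽¹⁾ < ∞`, and `w ∈ Σ*`, the `U × V` matrix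
`Z̄_{η,w}[u,v] = ∑_x η^{|x|}·(1_{w=uvx} − p(uvx))` satisfies
`‖Z̄_{η,w}‖₂ ≤ min(ℓ+1, 1/(1−η)) + S_{p̄_η}⁽¹⁾`, where `1/(1−η)` is interpreted as `+∞`
when `η = 1` (so that the bound reads `ℓ + 1 + S_{p̄_η}⁽¹⁾` in that case). -/
theorem prefix_hankel_summand_norm_bound_bounded_lengths {α : Type*} [Fintype α]
    [DecidableEq α]
    (p : List α → ℝ) (hp0 : ∀ w, 0 ≤ p w) (hp1 : HasSum p 1)
    (η : ℝ) (hη0 : 0 ≤ η) (hη1 : η ≤ 1)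
    (U V : Finset (List α)) (ℓ : ℕ)
    (hUV : ∀ u ∈ U ∪ V, u.length ≤ ℓ)
    (hS1 : Summable fun u : List α => ∑' x : List α, η ^ x.length * p (u ++ x))
    (w : List α)
    (Z : Matrix ↥U ↥V ℝ)
    (hZ : ∀ (u : ↥U) (v : ↥V), Z u v =
      ∑' x : List α, η ^ x.length *
        ((if w = ↑u ++ ↑v ++ x then 1 else 0) - p (↑u ++ ↑v ++ x))) :
    (η < 1 → specNorm Z ≤
        min ((ℓ : ℝ) + 1) (1 / (1 - η)) +
          (∑' u : List α, ∑' x : List α, η ^ x.length * p (u ++ x))) ∧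
    specNorm Z ≤ (ℓ : ℝ) + 1 +
        (∑' u : List α, ∑' x : List α, η ^ x.length * p (u ++ x)) := by
  set g : List α → ℝ := fun y => ∑' x : List α, η ^ x.length * p (y ++ x) with hg
  set f : List α → ℝ := fun y => if y <+: w then η ^ (w.length - y.length) else 0 with hf
  have hg0 (y : List α) : 0 ≤ g y := tsum_nonneg fun x => mul_nonneg (pow_nonneg hη0 _) (hp0 _)
  have hf0 (y : List α) : 0 ≤ f y := by
    simp only [hf]
    positivity
  have hZfg (u : U) (v : V) : Z u v = f (u ++ v) - g (u ++ v) := by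
    rw [hZ]
    simp_rw [mul_sub]
    exact ((hasSum_pow_length_mul_indicator η w _).sub
      (summable_pow_length_mul_append hp0 hp1.summable hη0 hη1 _).hasSum).tsum_eq
  have habs (u : U) (v : V) : |Z u v| ≤ f (u ++ v) + g (u ++ v) := by
    rw [hZfg]
    exact (abs_sub _ _).trans (by rw [abs_of_nonneg (hf0 _), abs_of_nonneg (hg0 _)])
  have hrowInj (u : U) : Function.Injective fun v : V => (u : List α) ++ v :=
    (List.append_right_injective _).comp Subtype.val_injective
  have hcolInj (v : V) : Function.Injective fun u : U => (u : List α) ++ v :=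
    (List.append_left_injective _).comp Subtype.val_injective
  have hbound {C : ℝ} (hC : 0 ≤ C) (hrow : ∀ u : U, ∑ v : V, f (u ++ v) ≤ C)
      (hcol : ∀ v : V, ∑ u : U, f (u ++ v) ≤ C) : specNorm Z ≤ C + ∑' y, g y := by
    refine specNorm_le_of_sum_abs_le Z (add_nonneg hC (tsum_nonneg hg0)) (fun u => ?_)
      fun v => ?_
    · refine (Finset.sum_le_sum fun v _ => habs u v).trans ?_
      rw [Finset.sum_add_distrib]
      exact add_le_add (hrow u) (sum_le_tsum_of_injective (hrowInj u) hg0 hS1)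
    · refine (Finset.sum_le_sum fun u _ => habs u v).trans ?_
      rw [Finset.sum_add_distrib]
      exact add_le_add (hcol v) (sum_le_tsum_of_injective (hcolInj v) hg0 hS1)
  have hrowLen (u : U) : ∑ v : V, f (u ++ v) ≤ (ℓ : ℝ) + 1 :=
    sum_prefix_pow_le_add_one (hrowInj u) hη0 hη1 w (c := (u : List α).length)
      (fun v => by simp)
      (fun v => by simpa using hUV v (Finset.mem_union_right _ v.2))
  have hcolLen (v : V) : ∑ u : U, f (u ++ v) ≤ (ℓ : ℝ) + 1 :=
    sum_prefix_pow_le_add_one (hcolInj v) hη0 hη1 w (c := (v : List α).length)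
      (fun u => by simp)
      (fun u => by
        have hu := hUV u (Finset.mem_union_left _ u.2)
        rw [List.length_append]
        omega)
  refine ⟨fun hη => ?_, hbound (by positivity) hrowLen hcolLen⟩
  exact hbound (le_min (by positivity) (one_div_nonneg.2 (sub_nonneg.2 hη1)))
    (fun u => le_min (hrowLen u) (sum_prefix_pow_le_geometric (hrowInj u) hη0 hη w))
    (fun v => le_min (hcolLen v) (sum_prefix_pow_le_geometric (hcolInj v) hη0 hη w))
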